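/- (Convergence of MSPipe, Theorem 1 made precise.) Let E be a real inner product space and L : E → ℝ a differentiable loss with L_f-Lipschitz gradient, L_f > 0, bounded below: there is W* with L(W*) ≤ L(x) for all x ∈ E. Fix a horizon T ≥ 1 with L_f ≤ √T and use the constant step size η = 1/√T. Generate iterates W_0, W_1, …, W_T by W_{t+1} = W_t − η g_t, t = 0, …, T−1, where each stale gradient g_t satisfies the staleness error bound ‖g_t − ∇L(W_t)‖² ≤ ρ ε_s and the alignment condition ⟪g_t − ∇L(W_t), ∇L(W_t)⟫ ≥ 0. Then min_{0 ≤ t ≤ T−1} ‖∇L(W_t)‖² ≤ ( 2·(L(W_0) − L(W*)) + ρ·L_f·ε_s ) / √T. In particular, training with ε_s-stale node-memory vectors converges at the rate O(T^{−1/2}), the same rate as vanilla (staleness-free) sampling-based GNN training. -/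

import Mathlib

open RealInnerProductSpace

/-- The descent lemma: a function with `K`-Lipschitz gradient lies below its quadratic upper
model. -/
theorem le_add_inner_gradient_add_sq {E : Type*} [NormedAddCommGroup E] [InnerProductSpace ℝ E]
    [CompleteSpace E] {L : E → ℝ} {K : ℝ} (hL : Differentiable ℝ L)
    (hgrad : ∀ x y : E, ‖gradient L x - gradient L y‖ ≤ K * ‖x - y‖) (x v : E) :
    L (x + v) ≤ L x + ⟪gradient L x, v⟫ + K / 2 * ‖v‖ ^ 2 := by
  set h : ℝ → ℝ := fun t => L (x + t • v) - t * ⟪gradient L x, v⟫ - K / 2 * ‖v‖ ^ 2 * t ^ 2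
    with h_def
  have hderiv (t : ℝ) : HasDerivAt h
      (⟪gradient L (x + t • v), v⟫ - ⟪gradient L x, v⟫ - K * ‖v‖ ^ 2 * t) t := by
    have hline : HasDerivAt (fun s : ℝ => x + s • v) v t := by
      simpa using ((hasDerivAt_id t).smul_const v).const_add x
    have hcomp : HasDerivAt (fun s : ℝ => L (x + s • v)) ⟪gradient L (x + t • v), v⟫ t := by
      simpa [Function.comp_def] using
        (hL (x + t • v)).hasGradientAt.hasFDerivAt.comp_hasDerivAt t hline
    refine ((hcomp.sub ((hasDerivAt_id t).mul_const ⟪gradient L x, v⟫)).sub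
      ((hasDerivAt_pow 2 t).const_mul (K / 2 * ‖v‖ ^ 2))).congr_deriv ?_
    norm_num
    ring
  have hanti : AntitoneOn h (Set.Ici 0) := by
    refine antitoneOn_of_deriv_nonpos (convex_Ici 0)
      (fun t _ => (hderiv t).continuousAt.continuousWithinAt)
      (fun t _ => (hderiv t).differentiableAt.differentiableWithinAt) fun t ht => ?_
    rw [interior_Ici, Set.mem_Ioi] at ht
    rw [(hderiv t).deriv, ← inner_sub_left, sub_nonpos]
    calc ⟪gradient L (x + t • v) - gradient L x, v⟫
        ≤ ‖gradient L (x + t • v) - gradient L x‖ * ‖v‖ := real_inner_le_norm _ _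
      _ ≤ K * ‖x + t • v - x‖ * ‖v‖ := by gcongr; exact hgrad _ _
      _ = K * ‖v‖ ^ 2 * t := by
        rw [add_sub_cancel_left, norm_smul, Real.norm_of_nonneg ht.le]
        ring
  have h01 := hanti Set.self_mem_Ici (Set.mem_Ici.mpr zero_le_one) zero_le_one
  simp only [h_def, one_smul, zero_smul, add_zero] at h01
  linarith

/-- One step of gradient descent with a gradient estimate `g` that is aligned with the true
gradient. -/
theorem sq_norm_gradient_le_of_aligned_step {E : Type*} [NormedAddCommGroup E]
    [InnerProductSpace ℝ E] [CompleteSpace E] {L : E → ℝ} {K η : ℝ} (hL : Differentiable ℝ L)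
    (hgrad : ∀ x y : E, ‖gradient L x - gradient L y‖ ≤ K * ‖x - y‖) (hη : 0 ≤ η)
    (hKη : K * η ≤ 1) (x g : E) (halign : 0 ≤ ⟪g - gradient L x, gradient L x⟫) :
    η * ‖gradient L x‖ ^ 2 ≤
      2 * (L x - L (x - η • g)) + K * η ^ 2 * ‖g - gradient L x‖ ^ 2 := by
  have hdesc := le_add_inner_gradient_add_sq hL hgrad x (-(η • g))
  set δ := g - gradient L x with hδ
  have hg : g = gradient L x + δ := by rw [hδ]; abel
  have hinner : ⟪gradient L x, g⟫ = ‖gradient L x‖ ^ 2 + ⟪δ, gradient L x⟫ := by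
    rw [hg, inner_add_right, real_inner_self_eq_norm_sq, real_inner_comm]
  have hnorm : ‖g‖ ^ 2 = ‖gradient L x‖ ^ 2 + 2 * ⟪δ, gradient L x⟫ + ‖δ‖ ^ 2 := by
    rw [hg, norm_add_sq_real, real_inner_comm]
  rw [← sub_eq_add_neg, norm_neg, norm_smul, mul_pow, Real.norm_of_nonneg hη, inner_neg_right,
    real_inner_smul_right, hinner, hnorm] at hdesc
  have hcoef : 0 ≤ η * (1 - K * η) := mul_nonneg hη (sub_nonneg.mpr hKη)
  linarith [mul_nonneg hcoef halign, mul_nonneg hcoef (sq_nonneg ‖gradient L x‖)]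

/-- Convergence of MSPipe (Theorem 1 made precise): with constant step size `η = 1/√T`,
`L_f ≤ √T`, stale gradients with error bound `‖g_t - ∇L(W_t)‖² ≤ ρ εs` and alignment
`⟪g_t - ∇L(W_t), ∇L(W_t)⟫ ≥ 0`, the smallest gradient norm seen satisfies
`min_{0 ≤ t < T} ‖∇L(W_t)‖² ≤ (2(L W_0 - L W*) + ρ L_f εs) / √T`. -/
theorem mspipe_convergence {E : Type*} [NormedAddCommGroup E] [InnerProductSpace ℝ E]
    [CompleteSpace E] (L : E → ℝ) (Lf ρ εs : ℝ) (hLf : 0 < Lf)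
    (hL : Differentiable ℝ L)
    (hgrad : ∀ x y : E, ‖gradient L x - gradient L y‖ ≤ Lf * ‖x - y‖)
    (Wstar : E) (hmin : ∀ x : E, L Wstar ≤ L x)
    (T : ℕ) (hT : 1 ≤ T) (hLfT : Lf ≤ Real.sqrt T)
    (W g : ℕ → E)
    (hstep : ∀ t < T, W (t + 1) = W t - (1 / Real.sqrt T) • g t)
    (hδ : ∀ t < T, ‖g t - gradient L (W t)‖ ^ 2 ≤ ρ * εs)
    (halign : ∀ t < T, 0 ≤ ⟪g t - gradient L (W t), gradient L (W t)⟫) :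
    (Finset.range T).inf' (Finset.nonempty_range_iff.mpr (Nat.one_le_iff_ne_zero.mp hT))
        (fun t => ‖gradient L (W t)‖ ^ 2) ≤
      (2 * (L (W 0) - L Wstar) + ρ * Lf * εs) / Real.sqrt T := by
  have hs : 0 < Real.sqrt T := Real.sqrt_pos.mpr (by exact_mod_cast hT)
  have hsq : Real.sqrt T ^ 2 = T := Real.sq_sqrt T.cast_nonneg
  set s := Real.sqrt T
  set m := (Finset.range T).inf' (Finset.nonempty_range_iff.mpr (Nat.one_le_iff_ne_zero.mp hT))
    (fun t => ‖gradient L (W t)‖ ^ 2)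
  have hstep_le (t : ℕ) (ht : t ∈ Finset.range T) :
      1 / s * m ≤ 2 * (L (W t) - L (W (t + 1))) + Lf * (1 / s) ^ 2 * (ρ * εs) := by
    have htT := Finset.mem_range.mp ht
    have hm : m ≤ ‖gradient L (W t)‖ ^ 2 := Finset.inf'_le _ ht
    rw [hstep t htT]
    calc 1 / s * m ≤ 1 / s * ‖gradient L (W t)‖ ^ 2 := by gcongr
      _ ≤ 2 * (L (W t) - L (W t - (1 / s) • g t))
          + Lf * (1 / s) ^ 2 * ‖g t - gradient L (W t)‖ ^ 2 :=
        sq_norm_gradient_le_of_aligned_step hL hgrad (by positivity)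
          (by rwa [mul_one_div, div_le_one hs]) _ _ (halign t htT)
      _ ≤ _ := by gcongr; exact hδ t htT
  have hsum := Finset.sum_le_sum hstep_le
  rw [Finset.sum_add_distrib, ← Finset.mul_sum _ _ (2 : ℝ), Finset.sum_range_sub', Finset.sum_const,
    Finset.sum_const, Finset.card_range, nsmul_eq_mul, nsmul_eq_mul, ← hsq] at hsum
  have hleft : s ^ 2 * (1 / s * m) = m * s := by field_simp
  have hright : s ^ 2 * (Lf * (1 / s) ^ 2 * (ρ * εs)) = ρ * Lf * εs := by field_simp
  rw [hleft, hright] at hsum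
  rw [le_div_iff₀ hs]
  linarith [hmin (W T)]
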